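/- arXiv:2208.02999 — 11 statements merged into one kernel-verified Lean document; each statement's English description precedes it below -/
import Mathlib

section
/- Let ν ∈ (0,1], and let p_s > 0, p_b ≥ 0, r ∈ [0,1] be real numbers. Then for every real y with −p_s ≤ y ≤ 0 one has p_s^ν + (1 − r)·((p_s + y + p_b)^ν − (p_s + p_b)^ν) ≥ (p_s + y)^ν. -/
/-- A concave function has decreasing increments. -/
theorem ConcaveOn.add_le_add_of_nonneg {s : Set ℝ} {f : ℝ → ℝ} (hf : ConcaveOn ℝ s f)
    {a h k : ℝ} (ha : a ∈ s) (hahk : a + h + k ∈ s) (hh : 0 ≤ h) (hk : 0 ≤ k) :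
    f a + f (a + h + k) ≤ f (a + h) + f (a + k) := by
  rcases (add_nonneg hh hk).eq_or_lt with h0 | hpos
  · obtain rfl : h = 0 := by linarith
    obtain rfl : k = 0 := by linarith
    simp
  · have hne : h + k ≠ 0 := hpos.ne'
    have hw : k / (h + k) + h / (h + k) = 1 := by field_simp; ring
    have hh' : 0 ≤ h / (h + k) := by positivity
    have hk' : 0 ≤ k / (h + k) := by positivity
    have h₁ := hf.2 ha hahk hk' hh' hw
    have h₂ := hf.2 ha hahk hh' hk' (by rw [add_comm, hw])
    simp only [smul_eq_mul] at h₁ h₂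
    rw [show k / (h + k) * a + h / (h + k) * (a + h + k) = a + h by field_simp; ring] at h₁
    rw [show h / (h + k) * a + k / (h + k) * (a + h + k) = a + k by field_simp; ring] at h₂
    linear_combination h₁ + h₂ - (f a + f (a + h + k)) * hw


/-- Pointwise utility-comparison lemma for risk-averse nodes with utility `U(x) = x^ν`:
for `ν ∈ (0,1]`, collateral `p_s > 0`, bribe `p_b ≥ 0`, probability `r ∈ [0,1]`, and
slashing payoff `y ∈ [-p_s, 0]`,
`p_s^ν + (1 - r)·((p_s + y + p_b)^ν - (p_s + p_b)^ν) ≥ (p_s + y)^ν`. -/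
theorem bribe_pointwise_utility_comparison (ν p_s p_b r y : ℝ)
    (hν0 : 0 < ν) (hν1 : ν ≤ 1) (hps : 0 < p_s) (hpb : 0 ≤ p_b)
    (hr0 : 0 ≤ r) (hr1 : r ≤ 1) (hy0 : -p_s ≤ y) (hy1 : y ≤ 0) :
    p_s ^ ν + (1 - r) * ((p_s + y + p_b) ^ ν - (p_s + p_b) ^ ν) ≥ (p_s + y) ^ ν := by
  have hinc := (Real.concaveOn_rpow hν0.le hν1).add_le_add_of_nonneg
    (a := p_s + y) (h := -y) (k := p_b)
    (Set.mem_Ici.2 (by linarith)) (Set.mem_Ici.2 (by linarith)) (by linarith) hpb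
  rw [add_neg_cancel_right] at hinc
  have hmono : (p_s + y + p_b) ^ ν ≤ (p_s + p_b) ^ ν :=
    Real.rpow_le_rpow (by linarith) (by linarith) hν0.le
  have hr : 0 ≤ r * ((p_s + p_b) ^ ν - (p_s + y + p_b) ^ ν) :=
    mul_nonneg hr0 (sub_nonneg.2 hmono)
  linarith
end

section
/- Let (Ω, μ) be a probability space, let ν ∈ (0,1], p_s > 0, p_b ≥ 0, r ∈ [0,1] be real numbers, and let Y : Ω → ℝ be a measurable function with −p_s ≤ Y(ω) ≤ 0 for μ-almost every ω. Then p_s^ν + (1 − r)·(∫ (p_s + Y(ω) + p_b)^ν dμ(ω) − (p_s + p_b)^ν) ≥ ∫ (p_s + Y(ω))^ν dμ(ω). -/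
open MeasureTheory

/-- The increments of a concave function over steps of a fixed length are decreasing. -/
theorem ConcaveOn.add_le_add_of_le {s : Set ℝ} {f : ℝ → ℝ} (hf : ConcaveOn ℝ s f)
    {a b c : ℝ} (ha : a ∈ s) (hcb : c + b ∈ s) (hac : a ≤ c) (hb : 0 ≤ b) :
    f a + f (c + b) ≤ f (a + b) + f c := by
  obtain h | h : c - a + b = 0 ∨ 0 < c - a + b := by
    rcases (show 0 ≤ c - a + b by linarith).eq_or_lt with h | h
    · exact Or.inl h.symm
    · exact Or.inr h
  · obtain rfl : b = 0 := by linarith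
    simp
  · have hsum : (c - a) / (c - a + b) + b / (c - a + b) = 1 := by
      rw [← add_div, div_self h.ne']
    have hp : 0 ≤ (c - a) / (c - a + b) := div_nonneg (by linarith) h.le
    have hq : 0 ≤ b / (c - a + b) := div_nonneg hb h.le
    have h₁ := hf.2 ha hcb hp hq hsum
    have h₂ := hf.2 ha hcb hq hp (by rw [add_comm, hsum])
    have e₁ : (c - a) / (c - a + b) * a + b / (c - a + b) * (c + b) = a + b := by
      field_simp
      ring
    have e₂ : b / (c - a + b) * a + (c - a) / (c - a + b) * (c + b) = c := by
      field_simp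
      ring
    simp only [smul_eq_mul, e₁, e₂] at h₁ h₂
    linear_combination h₁ + h₂ - (f a + f (c + b)) * hsum

/-- A nonnegative power of an almost surely bounded nonnegative function is integrable. -/
theorem MeasureTheory.integrable_rpow_of_ae_mem_Icc {Ω : Type*} [MeasurableSpace Ω]
    {μ : Measure Ω} [IsFiniteMeasure μ] {ν M : ℝ} (hν : 0 ≤ ν) {X : Ω → ℝ}
    (hX : Measurable X) (hbd : ∀ᵐ ω ∂μ, X ω ∈ Set.Icc 0 M) :
    Integrable (fun ω => X ω ^ ν) μ := by
  refine Integrable.of_bound (hX.pow_const ν).aestronglyMeasurable (M ^ ν) ?_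
  filter_upwards [hbd] with ω hω
  rw [Real.norm_of_nonneg (Real.rpow_nonneg hω.1 ν)]
  exact Real.rpow_le_rpow hω.1 hω.2 hν

/-- Expected-utility comparison lemma (Lemma 2 in the proof of security optimality for
risk-averse nodes): for a probability measure `μ`, `ν ∈ (0,1]`, collateral `p_s > 0`,
bribe `p_b ≥ 0`, `r ∈ [0,1]`, and a measurable random slashing payoff `Y` with
`-p_s ≤ Y ≤ 0` a.e.,
`p_s^ν + (1 - r)·(∫ (p_s + Y + p_b)^ν dμ - (p_s + p_b)^ν) ≥ ∫ (p_s + Y)^ν dμ`. -/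
theorem bribe_expected_utility_comparison {Ω : Type*} [MeasurableSpace Ω]
    (μ : Measure Ω) [IsProbabilityMeasure μ]
    (ν p_s p_b r : ℝ) (hν0 : 0 < ν) (hν1 : ν ≤ 1) (hps : 0 < p_s) (hpb : 0 ≤ p_b)
    (hr0 : 0 ≤ r) (hr1 : r ≤ 1)
    (Y : Ω → ℝ) (hY : Measurable Y)
    (hbd : ∀ᵐ ω ∂μ, -p_s ≤ Y ω ∧ Y ω ≤ 0) :
    p_s ^ ν + (1 - r) * ((∫ ω, (p_s + Y ω + p_b) ^ ν ∂μ) - (p_s + p_b) ^ ν)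
      ≥ ∫ ω, (p_s + Y ω) ^ ν ∂μ := by
  have hint₁ : Integrable (fun ω => (p_s + Y ω) ^ ν) μ := by
    refine integrable_rpow_of_ae_mem_Icc (M := p_s) hν0.le (by fun_prop) ?_
    filter_upwards [hbd] with ω hω
    constructor <;> linarith
  have hint₂ : Integrable (fun ω => (p_s + Y ω + p_b) ^ ν) μ := by
    refine integrable_rpow_of_ae_mem_Icc (M := p_s + p_b) hν0.le (by fun_prop) ?_
    filter_upwards [hbd] with ω hω
    constructor <;> linarith
  have hconc : (∫ ω, (p_s + Y ω) ^ ν ∂μ) + (p_s + p_b) ^ ν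
      ≤ (∫ ω, (p_s + Y ω + p_b) ^ ν ∂μ) + p_s ^ ν := by
    have h := integral_mono_ae (hint₁.add (integrable_const ((p_s + p_b) ^ ν)))
      (hint₂.add (integrable_const (p_s ^ ν))) (by
        filter_upwards [hbd] with ω hω
        exact (Real.concaveOn_rpow hν0.le hν1).add_le_add_of_le
          (Set.mem_Ici.2 (by linarith)) (Set.mem_Ici.2 (by linarith)) (by linarith) hpb)
    simpa [integral_add hint₁ (integrable_const _), integral_add hint₂ (integrable_const _)]
      using h
  have hmono : ∫ ω, (p_s + Y ω + p_b) ^ ν ∂μ ≤ (p_s + p_b) ^ ν := by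
    have h := integral_mono_ae hint₂ (integrable_const ((p_s + p_b) ^ ν)) (by
      filter_upwards [hbd] with ω hω
      exact Real.rpow_le_rpow (by linarith) (by linarith) hν0.le)
    simpa using h
  linarith [mul_nonneg hr0 (sub_nonneg.2 hmono)]
end

section
/- Fix integers n, m with 1 ≤ m ≤ n and real numbers p_w, p_s, p_0 with 0 ≤ p_w < p_s and p_0 ≥ 0. Let 𝒢 be the collection of all m-element subsets of {1,…,n}, and for each i ∈ {1,…,n} let 𝒢_i = {G ∈ 𝒢 : i ∈ G}. Suppose x : 𝒢 → ℝ satisfies x_G ≥ 0 for all G ∈ 𝒢, and p_b : {1,…,n} → ℝ satisfies p_b(i) ≥ 0 for all i and ∑_{i=1}^n p_b(i) ≤ p_0, and suppose for every i ∈ {1,…,n} we have ∑_{G ∈ 𝒢_i} x_G ≤ p_b(i)/(p_s − p_w). Then ∑_{G ∈ 𝒢} x_G ≤ p_0 / (m·(p_s − p_w)). -/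
/-- Double counting: summing a weight on `m`-element subsets over all incident pairs
`i ∈ G` counts every subset `m` times. -/
theorem sum_sum_filter_mem_powersetCard {ι : Type*} [Fintype ι] [DecidableEq ι]
    (m : ℕ) (x : Finset ι → ℝ) :
    ∑ i, ∑ G ∈ (Finset.powersetCard m (Finset.univ : Finset ι)).filter (fun G => i ∈ G), x G
      = m * ∑ G ∈ Finset.powersetCard m (Finset.univ : Finset ι), x G := by
  simp_rw [Finset.sum_filter]
  rw [Finset.sum_comm, Finset.mul_sum]
  refine Finset.sum_congr rfl fun G hG => ?_
  simp [Finset.sum_ite_mem, (Finset.mem_powersetCard.mp hG).2]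

/-- Upper bound of Theorem 5 (risk-neutral case): with `𝒢` the `m`-element subsets of an
`n`-element set, nonnegative weights `x_G` satisfying the per-node rationality constraint
`∑_{G ∋ i} x_G ≤ p_b(i)/(p_s − p_w)` and nonnegative bribes summing to at most `p_0`,
the total weight satisfies `∑_G x_G ≤ p_0/(m·(p_s − p_w))`. -/
theorem risk_neutral_failure_probability_upper_bound
    (n m : ℕ) (hm1 : 1 ≤ m) (hmn : m ≤ n)
    (p_w p_s p_0 : ℝ) (hw : 0 ≤ p_w) (hws : p_w < p_s) (hp0 : 0 ≤ p_0)
    (x : Finset (Fin n) → ℝ) (p_b : Fin n → ℝ)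
    (hx : ∀ G ∈ Finset.powersetCard m (Finset.univ : Finset (Fin n)), 0 ≤ x G)
    (hpb : ∀ i, 0 ≤ p_b i) (hsum : ∑ i, p_b i ≤ p_0)
    (hcon : ∀ i : Fin n,
      ∑ G ∈ (Finset.powersetCard m (Finset.univ : Finset (Fin n))).filter
          (fun G => i ∈ G), x G ≤ p_b i / (p_s - p_w)) :
    ∑ G ∈ Finset.powersetCard m (Finset.univ : Finset (Fin n)), x G
      ≤ p_0 / (m * (p_s - p_w)) := by
  have hd : 0 < p_s - p_w := sub_pos.mpr hws
  have hm : (0 : ℝ) < m := by exact_mod_cast hm1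
  have hcount := sum_sum_filter_mem_powersetCard m x
  have hle : (m : ℝ) * ∑ G ∈ Finset.powersetCard m (Finset.univ : Finset (Fin n)), x G
      ≤ p_0 / (p_s - p_w) := by
    rw [← hcount]
    calc _ ≤ ∑ i, p_b i / (p_s - p_w) := Finset.sum_le_sum fun i _ => hcon i
      _ = (∑ i, p_b i) / (p_s - p_w) := (Finset.sum_div _ _ _).symm
      _ ≤ p_0 / (p_s - p_w) := by gcongr
  rw [le_div_iff₀ hd] at hle
  rw [le_div_iff₀ (mul_pos hm hd)]
  linarith
end

section
/- Fix reals p_w, p_s with 0 < p_w < p_s and ν ∈ (0,1], and define f : [0,∞) → ℝ by f(x) = ((x + p_s)^ν − p_s^ν) / ((x + p_s)^ν − (x + p_w)^ν), where t^ν is the real power (the denominator is positive since p_s > p_w). Fix integers n, m with 1 ≤ m ≤ n, let 𝒢 be the collection of all m-element subsets of {1,…,n}, and for each i let 𝒢_i = {G ∈ 𝒢 : i ∈ G}. Suppose p_0 ≥ 0, x : 𝒢 → [0,1], p_b : {1,…,n} → [0,∞) with ∑_{i=1}^n p_b(i) ≤ p_0, and ∑_{G ∈ 𝒢_i} x_G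 ≤ f(p_b(i)) for every i. Then ∑_{G ∈ 𝒢} x_G ≤ (1/m)·f(p_0). -/
/-- The secant slopes of `t ↦ t ^ ν` through `1` decrease, since the function is concave. -/
theorem antitoneOn_one_sub_rpow_div_one_sub {ν : ℝ} (hν0 : 0 ≤ ν) (hν1 : ν ≤ 1) :
    AntitoneOn (fun t : ℝ => (1 - t ^ ν) / (1 - t)) (Set.Ico 0 1) := by
  intro a ha b hb hab
  have h := (Real.concaveOn_rpow hν0 hν1).neg.secant_mono
    (Set.mem_Ici.2 zero_le_one) (Set.mem_Ici.2 ha.1) (Set.mem_Ici.2 hb.1) ha.2.ne hb.2.ne hab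
  simp only [Pi.neg_apply, Real.one_rpow] at h
  have key (t : ℝ) : (-t ^ ν - -1) / (t - 1) = -((1 - t ^ ν) / (1 - t)) := by
    rw [← neg_sub 1 t, div_neg]
    ring
  rw [key, key] at h
  exact neg_le_neg_iff.1 h

theorem one_sub_rpow_div_one_sub_pos {ν t : ℝ} (hν : 0 < ν) (ht : t ∈ Set.Ico (0 : ℝ) 1) :
    0 < (1 - t ^ ν) / (1 - t) :=
  div_pos (sub_pos.2 (Real.rpow_lt_one ht.1 ht.2 hν)) (sub_pos.2 ht.2)

/-- A difference of powers, expressed through the secant slope of `t ↦ t ^ ν` at `a / b`. -/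
theorem rpow_sub_rpow_eq_secant {ν a b : ℝ} (ha : 0 ≤ a) (hab : a < b) :
    b ^ ν - a ^ ν = b ^ ν / b * (b - a) * ((1 - (a / b) ^ ν) / (1 - a / b)) := by
  have hb : 0 < b := ha.trans_lt hab
  have hbν : 0 < b ^ ν := Real.rpow_pos_of_pos hb ν
  have hba : b - a ≠ 0 := (sub_pos.2 hab).ne'
  have h1 : 1 - a / b = (b - a) / b := by field_simp
  rw [Real.div_rpow ha hb.le, h1]
  field_simp

/-- The largest withholding probability that is rational for a node offered the bribe `x`. -/
noncomputable def withholdingBound (w s ν x : ℝ) : ℝ :=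
  ((x + s) ^ ν - s ^ ν) / ((x + s) ^ ν - (x + w) ^ ν)

theorem withholdingBound_zero (w s ν : ℝ) : withholdingBound w s ν 0 = 0 := by
  simp [withholdingBound]

theorem withholdingBound_nonneg {w s ν x : ℝ} (hw : 0 ≤ w) (hws : w ≤ s) (hν : 0 ≤ ν)
    (hx : 0 ≤ x) : 0 ≤ withholdingBound w s ν x :=
  div_nonneg
    (sub_nonneg.2 (Real.rpow_le_rpow (hw.trans hws) (by linarith) hν))
    (sub_nonneg.2 (Real.rpow_le_rpow (by linarith) (by linarith) hν))

theorem withholdingBound_eq {w s ν x : ℝ} (hw : 0 ≤ w) (hws : w < s) (hx : 0 < x) :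
    withholdingBound w s ν x = x / (s - w) *
      (((1 - (s / (x + s)) ^ ν) / (1 - s / (x + s))) /
        ((1 - ((x + w) / (x + s)) ^ ν) / (1 - (x + w) / (x + s)))) := by
  have hxs : 0 < x + s := by linarith
  have hc : (x + s) ^ ν / (x + s) ≠ 0 := (div_pos (Real.rpow_pos_of_pos hxs ν) hxs).ne'
  rw [withholdingBound, rpow_sub_rpow_eq_secant (hw.trans hws.le) (by linarith : s < x + s),
    rpow_sub_rpow_eq_secant (by linarith : 0 ≤ x + w) (by linarith : x + w < x + s),
    add_sub_cancel_right, add_sub_add_left_eq_sub, mul_div_mul_comm, mul_div_mul_left _ _ hc]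

/-- The ratio `withholdingBound w s ν x / x` increases with `x`. -/
theorem withholdingBound_le_div_mul {w s ν x y : ℝ} (hw : 0 ≤ w) (hws : w < s) (hν0 : 0 < ν)
    (hν1 : ν ≤ 1) (hx : 0 ≤ x) (hxy : x ≤ y) :
    withholdingBound w s ν x ≤ x / y * withholdingBound w s ν y := by
  rcases hx.eq_or_lt with rfl | hx
  · simp [withholdingBound_zero]
  have hy : 0 < y := hx.trans_le hxy
  have hs : 0 < s := hw.trans_lt hws
  have hxs : 0 < x + s := by linarith
  have hys : 0 < y + s := by linarith
  have mem_s {z : ℝ} (hz : 0 < z) : s / (z + s) ∈ Set.Ico (0 : ℝ) 1 :=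
    ⟨by positivity, (div_lt_one (by linarith)).2 (by linarith)⟩
  have mem_w {z : ℝ} (hz : 0 < z) : (z + w) / (z + s) ∈ Set.Ico (0 : ℝ) 1 :=
    ⟨by positivity, (div_lt_one (by linarith)).2 (by linarith)⟩
  have h_num := antitoneOn_one_sub_rpow_div_one_sub hν0.le hν1 (mem_s hy) (mem_s hx)
    (div_le_div_of_nonneg_left hs.le hxs (by linarith))
  have h_den := antitoneOn_one_sub_rpow_div_one_sub hν0.le hν1 (mem_w hx) (mem_w hy)
    ((div_le_div_iff₀ hxs hys).2 (by nlinarith))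
  have h_ratio := div_le_div₀ (one_sub_rpow_div_one_sub_pos hν0 (mem_s hy)).le h_num
    (one_sub_rpow_div_one_sub_pos hν0 (mem_w hy)) h_den
  rw [withholdingBound_eq hw hws hx, withholdingBound_eq hw hws hy, ← mul_assoc,
    div_mul_div_cancel₀ hy.ne']
  exact mul_le_mul_of_nonneg_left h_ratio (div_nonneg hx.le (sub_nonneg.2 hws.le))

theorem sum_withholdingBound_le {ι : Type*} [Fintype ι] {w s ν p : ℝ} {b : ι → ℝ}
    (hw : 0 ≤ w) (hws : w < s) (hν0 : 0 < ν) (hν1 : ν ≤ 1)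
    (hb : ∀ i, 0 ≤ b i) (hsum : ∑ i, b i ≤ p) :
    ∑ i, withholdingBound w s ν (b i) ≤ withholdingBound w s ν p := by
  have hp : 0 ≤ p := (Finset.sum_nonneg fun i _ => hb i).trans hsum
  have hbp (i : ι) : b i ≤ p :=
    (Finset.single_le_sum (fun j _ => hb j) (Finset.mem_univ i)).trans hsum
  calc ∑ i, withholdingBound w s ν (b i)
      ≤ ∑ i, b i / p * withholdingBound w s ν p :=
        Finset.sum_le_sum fun i _ =>
          withholdingBound_le_div_mul hw hws hν0 hν1 (hb i) (hbp i)
    _ = (∑ i, b i) / p * withholdingBound w s ν p := by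
        rw [← Finset.sum_mul, Finset.sum_div]
    _ ≤ withholdingBound w s ν p :=
        mul_le_of_le_one_left (withholdingBound_nonneg hw hws.le hν0.le hp)
          (div_le_one_of_le₀ hsum hp)

/-- Upper bound in Theorem 10 (risk-averse case): with
`f(x) = ((x + p_s)^ν − p_s^ν)/((x + p_s)^ν − (x + p_w)^ν)`, weights `x_G ∈ [0,1]` on the
`m`-element subsets of an `n`-element set satisfying `∑_{G ∋ i} x_G ≤ f(p_b(i))` for
nonnegative bribes summing to at most `p_0`, one has `∑_G x_G ≤ (1/m)·f(p_0)`. -/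
theorem risk_averse_failure_probability_upper_bound
    (p_w p_s ν : ℝ) (hw : 0 < p_w) (hws : p_w < p_s) (hν0 : 0 < ν) (hν1 : ν ≤ 1)
    (f : ℝ → ℝ)
    (hf : ∀ x : ℝ, 0 ≤ x →
      f x = ((x + p_s) ^ ν - p_s ^ ν) / ((x + p_s) ^ ν - (x + p_w) ^ ν))
    (n m : ℕ) (hm1 : 1 ≤ m) (hmn : m ≤ n)
    (p_0 : ℝ) (hp0 : 0 ≤ p_0)
    (x : Finset (Fin n) → ℝ) (p_b : Fin n → ℝ)
    (hx : ∀ G ∈ Finset.powersetCard m (Finset.univ : Finset (Fin n)),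
        0 ≤ x G ∧ x G ≤ 1)
    (hpb : ∀ i, 0 ≤ p_b i) (hsum : ∑ i, p_b i ≤ p_0)
    (hcon : ∀ i : Fin n,
      ∑ G ∈ (Finset.powersetCard m (Finset.univ : Finset (Fin n))).filter
          (fun G => i ∈ G), x G ≤ f (p_b i)) :
    ∑ G ∈ Finset.powersetCard m (Finset.univ : Finset (Fin n)), x G
      ≤ (1 / m) * f p_0 := by
  have hm : (0 : ℝ) < m := Nat.cast_pos.2 hm1
  rw [one_div, le_inv_mul_iff₀ hm, ← sum_sum_filter_mem_powersetCard, hf p_0 hp0]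
  calc _ ≤ ∑ i, withholdingBound p_w p_s ν (p_b i) :=
        Finset.sum_le_sum fun i _ => (hcon i).trans_eq (hf _ (hpb i))
    _ ≤ _ := sum_withholdingBound_le hw.le hws hν0 hν1 hpb hsum
end

section
/- Fix reals p_w, p_s with 0 < p_w < p_s and ν ∈ (0,1], and define f : [0,∞) → ℝ by f(x) = ((x + p_s)^ν − p_s^ν) / ((x + p_s)^ν − (x + p_w)^ν), where t^ν is the real power. Fix integers n, m with 1 ≤ m ≤ n, let 𝒢 be the collection of all m-element subsets of {1,…,n}, and for each i let 𝒢_i = {G ∈ 𝒢 : i ∈ G}. Suppose p_0 ≥ 0, x : 𝒢 → [0,1], p_b : {1,…,n} → ℝ with 0 ≤ p_b(i) ≤ p_s − p_w for every i and ∑_{i=1}^n p_b(i) ≤ p_0, and suppose ∑_{G ∈ 𝒢_i} x_G ≤ f(p_b(i)) for every i. Then ∑_{G ∈ 𝒢} x_G ≤ (1/m)·min( p_0/(p_s − p_w), f(p_0) ). -/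
open Finset in
/-- Double counting: summing the incidence sums over all points counts every `m`-subset `m` times. -/
lemma sum_powersetCard_filter_mem {α : Type*} [Fintype α] [DecidableEq α] (m : ℕ)
    (x : Finset α → ℝ) :
    ∑ i, ∑ G ∈ (powersetCard m (univ : Finset α)).filter (fun G => i ∈ G), x G
      = m * ∑ G ∈ powersetCard m (univ : Finset α), x G := by
  simp_rw [sum_filter]
  rw [sum_comm, mul_sum]
  refine sum_congr rfl fun G hG => ?_
  rw [← sum_filter, sum_const, nsmul_eq_mul, filter_univ_mem, (mem_powersetCard.mp hG).2]

/-- The slope of `t ↦ t ^ ν` between `r` and `1`. -/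
noncomputable def rpowSlope (ν r : ℝ) : ℝ := (1 - r ^ ν) / (1 - r)

lemma rpowSlope_pos {ν r : ℝ} (hν : 0 < ν) (h0 : 0 ≤ r) (h1 : r < 1) : 0 < rpowSlope ν r :=
  div_pos (sub_pos.mpr (Real.rpow_lt_one h0 h1 hν)) (sub_pos.mpr h1)

lemma rpowSlope_le_rpowSlope {ν a b : ℝ} (hν0 : 0 ≤ ν) (hν1 : ν ≤ 1) (h0 : 0 ≤ a)
    (hab : a ≤ b) (hb : b < 1) : rpowSlope ν b ≤ rpowSlope ν a := by
  have h := ConvexOn.secant_mono (Real.concaveOn_rpow hν0 hν1).neg (a := 1)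
    (Set.mem_Ici.mpr zero_le_one) (Set.mem_Ici.mpr h0) (Set.mem_Ici.mpr (h0.trans hab))
    (hab.trans_lt hb).ne hb.ne hab
  have slope_eq (r : ℝ) : (-r ^ ν - -1) / (r - 1) = -rpowSlope ν r := by
    rw [rpowSlope, ← neg_sub r 1, div_neg, neg_neg]
    ring
  simpa only [Pi.neg_apply, Real.one_rpow, slope_eq, neg_le_neg_iff] using h

lemma rpow_sub_rpow_eq_mul_rpowSlope {ν y z : ℝ} (hz : 0 ≤ z) (hy : 0 < y) :
    y ^ ν - z ^ ν = y ^ ν * ((y - z) / y * rpowSlope ν (z / y)) := by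
  have hyν : y ^ ν ≠ 0 := (Real.rpow_pos_of_pos hy ν).ne'
  rcases eq_or_ne z y with rfl | hzy
  · simp
  have h1 : y - z ≠ 0 := sub_ne_zero.mpr hzy.symm
  have h2 : 1 - z / y = (y - z) / y := by field_simp
  rw [rpowSlope, h2, Real.div_rpow hz hy.le]
  field_simp

/-- The cost-benefit ratio of a bribe `x` as a multiple of `x / (s - w)`. -/
lemma rpow_ratio_eq {ν w s x : ℝ} (hw : 0 < w) (hws : w < s) (hx : 0 ≤ x) :
    ((x + s) ^ ν - s ^ ν) / ((x + s) ^ ν - (x + w) ^ ν)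
      = x / (s - w) * (rpowSlope ν (s / (x + s)) / rpowSlope ν ((x + w) / (x + s))) := by
  have hy : 0 < x + s := by linarith
  have hyν : (x + s) ^ ν ≠ 0 := (Real.rpow_pos_of_pos hy ν).ne'
  rw [rpow_sub_rpow_eq_mul_rpowSlope (hw.trans hws).le hy,
    rpow_sub_rpow_eq_mul_rpowSlope (z := x + w) (by linarith) hy, mul_div_mul_left _ _ hyν,
    mul_div_mul_comm, div_div_div_cancel_right₀ hy.ne', add_sub_cancel_right,
    add_sub_add_left_eq_sub]

lemma rpowSlope_ratio_le_one {ν w s x : ℝ} (hν0 : 0 < ν) (hν1 : ν ≤ 1) (hw : 0 < w)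
    (hws : w < s) (hx : 0 < x) (hxs : x ≤ s - w) :
    rpowSlope ν (s / (x + s)) / rpowSlope ν ((x + w) / (x + s)) ≤ 1 := by
  have hy : 0 < x + s := by linarith
  have hxw : 0 ≤ (x + w) / (x + s) := div_nonneg (by linarith) hy.le
  rw [div_le_one (rpowSlope_pos hν0 hxw ((div_lt_one hy).mpr (by linarith)))]
  refine rpowSlope_le_rpowSlope hν0.le hν1 hxw ?_ ((div_lt_one hy).mpr (by linarith))
  exact div_le_div_of_nonneg_right (by linarith) hy.le

lemma rpowSlope_ratio_mono {ν w s x z : ℝ} (hν0 : 0 < ν) (hν1 : ν ≤ 1) (hw : 0 < w)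
    (hws : w < s) (hx : 0 < x) (hxz : x ≤ z) :
    rpowSlope ν (s / (x + s)) / rpowSlope ν ((x + w) / (x + s))
      ≤ rpowSlope ν (s / (z + s)) / rpowSlope ν ((z + w) / (z + s)) := by
  have hs : 0 < s := hw.trans hws
  have hz : 0 < z := hx.trans_le hxz
  have hxs : 0 < x + s := by linarith
  have hzs : 0 < z + s := by linarith
  have hz1 : (z + w) / (z + s) < 1 := (div_lt_one hzs).mpr (by linarith)
  have hz2 : s / (z + s) < 1 := (div_lt_one hzs).mpr (by linarith)
  refine div_le_div₀ (rpowSlope_pos hν0 (by positivity) hz2).le ?_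
    (rpowSlope_pos hν0 (by positivity) hz1) ?_
  · refine rpowSlope_le_rpowSlope hν0.le hν1 (by positivity) ?_
      ((div_lt_one hxs).mpr (by linarith))
    exact div_le_div_of_nonneg_left hs.le hxs (by linarith)
  · refine rpowSlope_le_rpowSlope hν0.le hν1 (by positivity) ?_ hz1
    rw [div_le_div_iff₀ hxs hzs]
    nlinarith [mul_nonneg (sub_nonneg.mpr hxz) (sub_nonneg.mpr hws.le)]


/-- Full upper bound of Theorem 10: with
`f(x) = ((x + p_s)^ν − p_s^ν)/((x + p_s)^ν − (x + p_w)^ν)`, weights `x_G ∈ [0,1]` on the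
`m`-element subsets of an `n`-element set satisfying `∑_{G ∋ i} x_G ≤ f(p_b(i))` for
bribes `0 ≤ p_b(i) ≤ p_s − p_w` summing to at most `p_0`, one has
`∑_G x_G ≤ (1/m)·min(p_0/(p_s − p_w), f(p_0))`. -/
theorem risk_averse_failure_probability_full_upper_bound
    (p_w p_s ν : ℝ) (hw : 0 < p_w) (hws : p_w < p_s) (hν0 : 0 < ν) (hν1 : ν ≤ 1)
    (f : ℝ → ℝ)
    (hf : ∀ x : ℝ, 0 ≤ x →
      f x = ((x + p_s) ^ ν - p_s ^ ν) / ((x + p_s) ^ ν - (x + p_w) ^ ν))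
    (n m : ℕ) (hm1 : 1 ≤ m) (hmn : m ≤ n)
    (p_0 : ℝ) (hp0 : 0 ≤ p_0)
    (x : Finset (Fin n) → ℝ) (p_b : Fin n → ℝ)
    (hx : ∀ G ∈ Finset.powersetCard m (Finset.univ : Finset (Fin n)),
        0 ≤ x G ∧ x G ≤ 1)
    (hpb : ∀ i, 0 ≤ p_b i ∧ p_b i ≤ p_s - p_w) (hsum : ∑ i, p_b i ≤ p_0)
    (hcon : ∀ i : Fin n,
      ∑ G ∈ (Finset.powersetCard m (Finset.univ : Finset (Fin n))).filter
          (fun G => i ∈ G), x G ≤ f (p_b i)) :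
    ∑ G ∈ Finset.powersetCard m (Finset.univ : Finset (Fin n)), x G
      ≤ (1 / m) * min (p_0 / (p_s - p_w)) (f p_0) := by
  have hΔ : 0 < p_s - p_w := sub_pos.mpr hws
  set ρ : ℝ → ℝ := fun t =>
    rpowSlope ν (p_s / (t + p_s)) / rpowSlope ν ((t + p_w) / (t + p_s)) with hρ
  have hfρ : ∀ t, 0 ≤ t → f t = t / (p_s - p_w) * ρ t := fun t ht => by
    rw [hf t ht, rpow_ratio_eq hw hws ht]
  have hbound : ∀ C : ℝ, 0 ≤ C → (∀ i, 0 < p_b i → ρ (p_b i) ≤ C) →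
      ∑ i, f (p_b i) ≤ p_0 / (p_s - p_w) * C := fun C hC h => by
    calc ∑ i, f (p_b i) ≤ ∑ i, p_b i / (p_s - p_w) * C := by
          refine Finset.sum_le_sum fun i _ => ?_
          rw [hfρ _ (hpb i).1]
          rcases (hpb i).1.eq_or_lt with h0 | h0
          · simp [← h0]
          · exact mul_le_mul_of_nonneg_left (h i h0) (div_pos h0 hΔ).le
      _ = (∑ i, p_b i) / (p_s - p_w) * C := by rw [← Finset.sum_mul, ← Finset.sum_div]
      _ ≤ p_0 / (p_s - p_w) * C := by gcongr
  have hle : ∀ i, p_b i ≤ p_0 := fun i =>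
    (Finset.single_le_sum (fun j _ => (hpb j).1) (Finset.mem_univ i)).trans hsum
  have hC : 0 ≤ ρ p_0 := by
    rcases hp0.eq_or_lt with h0 | h0
    · have hs : p_s ≠ 0 := (hw.trans hws).ne'
      simp [hρ, ← h0, div_self hs, rpowSlope]
    · have hy : 0 < p_0 + p_s := by linarith
      have hs : 0 < p_s := hw.trans hws
      exact div_nonneg
        (rpowSlope_pos hν0 (by positivity) ((div_lt_one hy).mpr (by linarith))).le
        (rpowSlope_pos hν0 (by positivity) ((div_lt_one hy).mpr (by linarith))).le
  have hlinear : ∑ i, f (p_b i) ≤ p_0 / (p_s - p_w) := by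
    simpa using hbound 1 zero_le_one fun i hi =>
      rpowSlope_ratio_le_one hν0 hν1 hw hws hi (hpb i).2
  have hpooled : ∑ i, f (p_b i) ≤ f p_0 := by
    rw [hfρ p_0 hp0]
    exact hbound _ hC fun i hi => rpowSlope_ratio_mono hν0 hν1 hw hws hi (hle i)
  have hm : (0 : ℝ) < m := by exact_mod_cast hm1
  rw [one_div, ← div_eq_inv_mul, le_div_iff₀' hm, ← sum_powersetCard_filter_mem]
  exact (Finset.sum_le_sum fun i _ => hcon i).trans (le_min hlinear hpooled)
end

section
/- Let p_w, p_s be real numbers with 0 < p_w < p_s, let ν ∈ (0,1], and let x be a real number with 0 ≤ x ≤ p_s − p_w. Then ((p_s + x)^ν − p_s^ν) / ((p_s + x)^ν − (p_w + x)^ν) ≤ x / (p_s − p_w). -/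
/-- For bribes `x ≤ p_s − p_w`, the maximal withholding probability of a risk-averse node
is at most that of a risk-neutral node:
`((p_s + x)^ν − p_s^ν)/((p_s + x)^ν − (p_w + x)^ν) ≤ x/(p_s − p_w)`. -/
theorem risk_averse_le_risk_neutral_withholding (p_w p_s ν x : ℝ)
    (hw : 0 < p_w) (hws : p_w < p_s) (hν0 : 0 < ν) (hν1 : ν ≤ 1)
    (hx0 : 0 ≤ x) (hx1 : x ≤ p_s - p_w) :
    ((p_s + x) ^ ν - p_s ^ ν) / ((p_s + x) ^ ν - (p_w + x) ^ ν) ≤ x / (p_s - p_w) := by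
  have hd : 0 < p_s - p_w := sub_pos.mpr hws
  have hlt : (p_w + x) ^ ν < (p_s + x) ^ ν :=
    Real.rpow_lt_rpow (by linarith) (by linarith) hν0
  have hconc := (Real.concaveOn_rpow hν0.le hν1).2
    (show p_w + x ∈ Set.Ici 0 from Set.mem_Ici.mpr (by linarith))
    (show p_s + x ∈ Set.Ici 0 from Set.mem_Ici.mpr (by linarith))
    (div_nonneg hx0 hd.le) (sub_nonneg.mpr ((div_le_one hd).mpr hx1))
    (add_sub_cancel (x / (p_s - p_w)) 1)
  have hcomb : x / (p_s - p_w) * (p_w + x) + (1 - x / (p_s - p_w)) * (p_s + x) = p_s := by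
    field_simp
    ring
  simp only [smul_eq_mul, hcomb] at hconc
  rw [div_le_iff₀ (sub_pos.mpr hlt)]
  linarith
end

section
/- Let p_w, p_s be real numbers with 0 < p_w < p_s and let ν ∈ (0,1]. Then the function f : ℝ → ℝ defined for x ≥ 0 by f(x) = ((x + p_s)^ν − p_s^ν) / ((x + p_s)^ν − (x + p_w)^ν) is convex on the interval [0,∞). -/
/-- A differentiable function on `(0, 1]` that vanishes at `1` and has nonpositive derivative is
nonnegative. -/
lemma nonneg_of_hasDerivAt_nonpos {g g' : ℝ → ℝ}
    (hg : ∀ r, 0 < r → HasDerivAt g (g' r) r) (hg' : ∀ r, 0 < r → r < 1 → g' r ≤ 0)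
    (h1 : g 1 = 0) {r : ℝ} (hr0 : 0 < r) (hr1 : r ≤ 1) : 0 ≤ g r := by
  have hanti : AntitoneOn g (Set.Ioc 0 1) := by
    refine antitoneOn_of_hasDerivWithinAt_nonpos (f' := g') (convex_Ioc 0 1)
      (fun x hx => (hg x hx.1).continuousAt.continuousWithinAt) (fun x hx => ?_) (fun x hx => ?_)
    all_goals rw [interior_Ioc] at hx
    · exact (hg x hx.1).hasDerivWithinAt
    · exact hg' x hx.1 hx.2
  rw [← h1]
  exact hanti ⟨hr0, hr1⟩ ⟨one_pos, le_rfl⟩ hr1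

lemma one_le_rpow_weighted {ν r : ℝ} (hν0 : 0 < ν) (hν1 : ν ≤ 1) (hr0 : 0 < r) :
    1 ≤ ν * r ^ (ν - 1) + (1 - ν) * r ^ ν := by
  have h := Real.geom_mean_le_arith_mean2_weighted hν0.le (sub_nonneg.2 hν1)
    (inv_pos.2 hr0).le zero_le_one (by ring)
  rw [Real.one_rpow, mul_one, mul_one, Real.inv_rpow hr0.le] at h
  have hY : 0 < r ^ ν := Real.rpow_pos_of_pos hr0 ν
  have h2 := mul_le_mul_of_nonneg_left h hY.le
  rw [mul_inv_cancel₀ hY.ne'] at h2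
  rw [Real.rpow_sub_one hr0.ne']
  calc (1 : ℝ) ≤ _ := h2
    _ = _ := by ring

lemma mixed_rpow_nonneg {ν r : ℝ} (hν0 : 0 < ν) (hν1 : ν ≤ 1) (hr0 : 0 < r) (hr1 : r ≤ 1) :
    0 ≤ (1 - ν) * (1 + r) * (1 - r ^ ν) - 2 * ν * (r ^ ν - r) := by
  refine nonneg_of_hasDerivAt_nonpos
    (g := fun r : ℝ => (1 - ν) * (1 + r) * (1 - r ^ ν) - 2 * ν * (r ^ ν - r))
    (g' := fun r => (1 + ν) * (1 - (ν * r ^ (ν - 1) + (1 - ν) * r ^ ν)))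
    (fun s hs => ?_) (fun s hs _ => ?_) (by simp) hr0 hr1
  · have hd := Real.hasDerivAt_rpow_const (p := ν) (Or.inl hs.ne')
    have hid := hasDerivAt_id' s
    convert! (((hid.const_add 1).const_mul (1 - ν)).mul (hd.const_sub 1)).sub
      ((hd.sub hid).const_mul (2 * ν)) using 1
    rw [Real.rpow_sub_one hs.ne']
    field_simp
    ring
  · have := one_le_rpow_weighted hν0 hν1 hs
    nlinarith

lemma five_term_rpow_nonneg {ν r : ℝ} (hν0 : 0 < ν) (hν1 : ν ≤ 1) (hr0 : 0 < r) (hr1 : r ≤ 1) :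
    0 ≤ ν * (1 + ν) - (1 - ν) * ν * r ^ ν + (1 - ν) * (2 + ν) * r - (1 + ν) * (r / r ^ ν)
      - (1 - ν) ^ 2 * (r * r ^ ν) := by
  refine nonneg_of_hasDerivAt_nonpos
    (g := fun r : ℝ => ν * (1 + ν) - (1 - ν) * ν * r ^ ν + (1 - ν) * (2 + ν) * r
      - (1 + ν) * (r / r ^ ν) - (1 - ν) ^ 2 * (r * r ^ ν))
    (g' := fun r => (1 - ν) * ((2 + ν) - ν ^ 2 * r ^ (ν - 1) - (1 + ν) / r ^ ν
      - (1 - ν ^ 2) * r ^ ν))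
    (fun s hs => ?_) (fun s hs hs1 => ?_) (by simp; ring) hr0 hr1
  · have hd := Real.hasDerivAt_rpow_const (p := ν) (Or.inl hs.ne')
    have hid := hasDerivAt_id' s
    have hY : 0 < s ^ ν := Real.rpow_pos_of_pos hs ν
    convert! (((((hd.const_mul ((1 - ν) * ν)).const_sub (ν * (1 + ν))).add
      (hid.const_mul ((1 - ν) * (2 + ν)))).sub ((hid.div hd hY.ne').const_mul (1 + ν))).sub
      ((hid.mul hd).const_mul ((1 - ν) ^ 2))) using 1
    rw [Real.rpow_sub_one hs.ne']
    field_simp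
    ring
  · have h := one_le_rpow_weighted hν0 hν1 hs
    have hY : 0 < s ^ ν := Real.rpow_pos_of_pos hs ν
    have hY1 : s ^ ν ≤ 1 := Real.rpow_le_one hs.le hs1.le hν0.le
    have h2 : 2 ≤ (1 + ν) / s ^ ν + (1 - ν) * s ^ ν := by
      rw [div_add' _ _ _ hY.ne', le_div_iff₀ hY]
      nlinarith [sq_nonneg (1 - s ^ ν), mul_nonneg hν0.le (sub_nonneg.2 hY1),
        mul_nonneg (mul_nonneg hν0.le (sub_nonneg.2 hY1)) hY.le]
    refine mul_nonpos_of_nonneg_of_nonpos (sub_nonneg.2 hν1) ?_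
    nlinarith [mul_le_mul_of_nonneg_left h hν0.le]

/-- The normalized nonnegativity of the second derivative, with `r = (x + p_w) / (x + p_s)` and
`γ = (p_s / (x + p_s)) ^ ν`. -/
lemma normalized_second_deriv_nonneg {ν r γ : ℝ} (hν0 : 0 < ν) (hν1 : ν ≤ 1) (hr0 : 0 < r)
    (hr1 : r < 1) (hγ : (1 - r) ^ ν ≤ γ) :
    (1 - r) * r ^ ν * ((1 - ν) * (1 + r) * (1 - r ^ ν) - 2 * ν * (r ^ ν - r)) ≤
      γ * ((1 - ν) * (r ^ ν - r ^ 2) * (1 - r ^ ν) - 2 * ν * (r ^ ν - r) ^ 2) := by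
  have hQ := mixed_rpow_nonneg hν0 hν1 hr0 hr1.le
  have hF := five_term_rpow_nonneg hν0 hν1 hr0 hr1.le
  have hY : 0 < r ^ ν := Real.rpow_pos_of_pos hr0 ν
  have hz : 0 < 1 - r := sub_pos.2 hr1
  have hγ0 : 0 < γ := (Real.rpow_pos_of_pos hz ν).trans_le hγ
  have hqr : 0 < 1 - (1 - ν) * r := by nlinarith
  have hbern : (1 - r) ^ (1 - ν) ≤ 1 - (1 - ν) * r := by
    have := rpow_one_add_le_one_add_mul_self (s := -r) (p := 1 - ν) (by linarith)
      (by linarith) (by linarith)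
    rw [← sub_eq_add_neg] at this
    linarith
  have hγ' : 1 - r ≤ γ * (1 - (1 - ν) * r) := by
    calc 1 - r = (1 - r) ^ ν * (1 - r) ^ (1 - ν) := by
          rw [← Real.rpow_add hz, add_sub_cancel, Real.rpow_one]
      _ ≤ _ := mul_le_mul hγ hbern (Real.rpow_nonneg hz.le _) hγ0.le
  set Y := r ^ ν
  set Q := (1 - ν) * (1 + r) * (1 - Y) - 2 * ν * (Y - r)
  have hP : (1 - (1 - ν) * r) * (Y * Q) ≤
      (1 - ν) * (Y - r ^ 2) * (1 - Y) - 2 * ν * (Y - r) ^ 2 := by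
    have hF' := mul_nonneg (mul_pos hr0 hY).le hF
    have e : r * Y * (ν * (1 + ν) - (1 - ν) * ν * Y + (1 - ν) * (2 + ν) * r - (1 + ν) * (r / Y)
        - (1 - ν) ^ 2 * (r * Y)) = (1 - ν) * (Y - r ^ 2) * (1 - Y) - 2 * ν * (Y - r) ^ 2
        - (1 - (1 - ν) * r) * (Y * Q) := by
      simp only [Q]
      field_simp
      ring
    linarith
  calc (1 - r) * Y * Q = (1 - r) * (Y * Q) := by ring
    _ ≤ γ * (1 - (1 - ν) * r) * (Y * Q) :=
        mul_le_mul_of_nonneg_right hγ' (mul_nonneg hY.le hQ)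
    _ = γ * ((1 - (1 - ν) * r) * (Y * Q)) := by ring
    _ ≤ _ := mul_le_mul_of_nonneg_left hP hγ0.le

lemma second_deriv_numerator_nonneg {a b c ν : ℝ} (hν0 : 0 < ν) (hν1 : ν ≤ 1) (hb : 0 < b)
    (hab : b < a) (hc : a - b ≤ c) :
    0 ≤ (1 - ν) * (c ^ ν * (a ^ 2 * b ^ ν - b ^ 2 * a ^ ν)
        - (a - b) * (a + b) * a ^ ν * b ^ ν) * (a ^ ν - b ^ ν)
      + 2 * ν * (a * b ^ ν - b * a ^ ν)
        * ((a - b) * a ^ ν * b ^ ν - c ^ ν * (a * b ^ ν - b * a ^ ν)) := by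
  have ha : 0 < a := hb.trans hab
  have hd : 0 < a - b := sub_pos.2 hab
  have hr1 : b / a < 1 := (div_lt_one ha).2 hab
  have hr : 1 - b / a = (a - b) / a := by field_simp
  have hγ : (1 - b / a) ^ ν ≤ c ^ ν / a ^ ν := by
    rw [hr, Real.div_rpow hd.le ha.le]
    gcongr
  have key := normalized_second_deriv_nonneg hν0 hν1 (div_pos hb ha) hr1 hγ
  rw [Real.div_rpow hb.le ha.le] at key
  have hA : 0 < a ^ ν := Real.rpow_pos_of_pos ha ν
  have := mul_nonneg (mul_pos (pow_pos ha 2) (pow_pos hA 3)).le (sub_nonneg.2 key)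
  convert! this using 1
  field_simp
  ring

/-- Convexity of the maximal withholding probability
`f(x) = ((x + p_s)^ν − p_s^ν)/((x + p_s)^ν − (x + p_w)^ν)` on `[0, ∞)`. -/
theorem withholding_probability_convexOn (p_w p_s ν : ℝ)
    (hw : 0 < p_w) (hws : p_w < p_s) (hν0 : 0 < ν) (hν1 : ν ≤ 1) :
    ConvexOn ℝ (Set.Ici (0 : ℝ))
      (fun x : ℝ => ((x + p_s) ^ ν - p_s ^ ν) / ((x + p_s) ^ ν - (x + p_w) ^ ν)) := by
  have hderiv : ∀ p : ℝ, 0 < p → ∀ e x : ℝ, 0 ≤ x →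
      HasDerivAt (fun y : ℝ => (y + p) ^ e) (e * (x + p) ^ (e - 1)) x := fun p hp e x hx => by
    simpa using ((hasDerivAt_id' x).add_const p).rpow_const (p := e)
      (Or.inl (add_pos_of_nonneg_of_pos hx hp).ne')
  have hs : 0 < p_s := hw.trans hws
  have hden : ∀ x : ℝ, 0 ≤ x → 0 < (x + p_s) ^ ν - (x + p_w) ^ ν := fun x hx =>
    sub_pos.2 (Real.rpow_lt_rpow (by positivity) (by linarith) hν0)
  have hf := fun x (hx : 0 ≤ x) => ((hderiv p_s hs ν x hx).sub_const (p_s ^ ν)).fun_div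
    ((hderiv p_s hs ν x hx).fun_sub (hderiv p_w hw ν x hx)) (hden x hx).ne'
  have hf' := fun x (hx : 0 ≤ x) =>
    ((((hderiv p_s hs (ν - 1) x hx).const_mul ν).fun_mul
        ((hderiv p_s hs ν x hx).fun_sub (hderiv p_w hw ν x hx))).fun_sub
      (((hderiv p_s hs ν x hx).sub_const (p_s ^ ν)).fun_mul
        (((hderiv p_s hs (ν - 1) x hx).const_mul ν).fun_sub
          ((hderiv p_w hw (ν - 1) x hx).const_mul ν)))).fun_div
      (((hderiv p_s hs ν x hx).fun_sub (hderiv p_w hw ν x hx)).fun_pow 2)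
      (pow_pos (hden x hx) 2).ne'
  refine convexOn_of_hasDerivWithinAt2_nonneg (convex_Ici 0)
    (fun x hx => (hf x hx).continuousAt.continuousWithinAt)
    (fun x hx => (hf x (interior_subset hx)).hasDerivWithinAt)
    (fun x hx => (hf' x (interior_subset hx)).hasDerivWithinAt) (fun x hx => ?_)
  replace hx : 0 ≤ x := interior_subset hx
  have ha : 0 < x + p_s := by positivity
  have hb : 0 < x + p_w := by positivity
  have hD := hden x hx
  have key := second_deriv_numerator_nonneg (c := p_s) hν0 hν1 hb
    (add_lt_add_right hws x) (by linarith)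
  simp only [Real.rpow_sub_one ha.ne', Real.rpow_sub_one hb.ne']
  generalize (x + p_s) ^ ν = A at *
  generalize (x + p_w) ^ ν = B at *
  generalize p_s ^ ν = C at *
  generalize x + p_s = a at *
  generalize x + p_w = b at *
  have := div_nonneg (mul_nonneg hν0.le key)
    (mul_pos (pow_pos (mul_pos ha hb) 2) (pow_pos hD 3)).le
  convert! this using 1
  have hD' := hD.ne'
  field_simp
  ring
end

section
/- Let p_w, p_s be real numbers with 0 < p_w < p_s and let ν ∈ (0,1]. Then the function f defined for x ≥ 0 by f(x) = ((x + p_s)^ν − p_s^ν) / ((x + p_s)^ν − (x + p_w)^ν) is monotone nondecreasing on [0,∞), and f(0) = 0. -/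
/-- A concave function has nonincreasing increments over intervals of fixed length. -/
theorem ConcaveOn.add_le_add_of_translate {s : Set ℝ} {g : ℝ → ℝ} (hg : ConcaveOn ℝ s g)
    {a b h : ℝ} (ha : a ∈ s) (hbh : b + h ∈ s) (hab : a ≤ b) (hh : 0 < h) :
    g a + g (b + h) ≤ g (a + h) + g b := by
  have hD : 0 < b - a + h := by linarith
  have hsum : (b - a) / (b - a + h) + h / (b - a + h) = 1 := by
    rw [← add_div, div_self hD.ne']
  have hu : 0 ≤ (b - a) / (b - a + h) := div_nonneg (by linarith) hD.le
  have hv : 0 ≤ h / (b - a + h) := div_nonneg hh.le hD.le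
  have h1 := hg.2 ha hbh hu hv hsum
  have h2 := hg.2 ha hbh hv hu (by rw [add_comm, hsum])
  simp only [smul_eq_mul] at h1 h2
  have e1 : (b - a) / (b - a + h) * a + h / (b - a + h) * (b + h) = a + h := by
    field_simp
    ring
  have e2 : h / (b - a + h) * a + (b - a) / (b - a + h) * (b + h) = b := by
    field_simp
    ring
  rw [e1] at h1
  rw [e2] at h2
  linear_combination h1 + h2 - (g a + g (b + h)) * hsum

/-- The maximal withholding probability
`f(x) = ((x + p_s)^ν − p_s^ν)/((x + p_s)^ν − (x + p_w)^ν)` is monotone nondecreasing on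
`[0, ∞)` and satisfies `f(0) = 0`. -/
theorem withholding_probability_monotoneOn_and_zero (p_w p_s ν : ℝ)
    (hw : 0 < p_w) (hws : p_w < p_s) (hν0 : 0 < ν) (hν1 : ν ≤ 1)
    (f : ℝ → ℝ)
    (hf : f = fun x : ℝ =>
      ((x + p_s) ^ ν - p_s ^ ν) / ((x + p_s) ^ ν - (x + p_w) ^ ν)) :
    MonotoneOn f (Set.Ici (0 : ℝ)) ∧ f 0 = 0 := by
  subst hf
  refine ⟨fun x hx y hy hxy => ?_, by simp⟩
  rw [Set.mem_Ici] at hx hy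
  have hden : (0 : ℝ) < (y + p_s) ^ ν - (y + p_w) ^ ν :=
    sub_pos.2 (Real.rpow_lt_rpow (by linarith) (by linarith) hν0)
  have hnum : (0 : ℝ) ≤ (y + p_s) ^ ν - p_s ^ ν :=
    sub_nonneg.2 (Real.rpow_le_rpow (by linarith) (by linarith) hν0.le)
  have hnum_le : (x + p_s) ^ ν ≤ (y + p_s) ^ ν :=
    Real.rpow_le_rpow (by linarith) (by linarith) hν0.le
  have hinc := (Real.concaveOn_rpow hν0.le hν1).add_le_add_of_translate
    (a := x + p_w) (b := y + p_w) (h := p_s - p_w)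
    (Set.mem_Ici.2 (by linarith)) (Set.mem_Ici.2 (by linarith)) (by linarith) (by linarith)
  rw [show y + p_w + (p_s - p_w) = y + p_s by ring,
    show x + p_w + (p_s - p_w) = x + p_s by ring] at hinc
  exact div_le_div₀ hnum (by linarith) hden (by linarith)
end

section
/- Let p_w, p_s be real numbers with 0 < p_w < p_s, let ν ∈ (0,1], and define f(x) = ((x + p_s)^ν − p_s^ν) / ((x + p_s)^ν − (x + p_w)^ν) for x ≥ 0. Let n ≥ 1 be an integer, let p_b(1), …, p_b(n) be nonnegative reals, and let p_0 ≥ 0 satisfy ∑_{i=1}^n p_b(i) ≤ p_0. Then ∑_{i=1}^n f(p_b(i)) ≤ f(p_0). -/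
theorem hasDerivAt_add_mul_rpow {a b ν t : ℝ} (h : 0 < a + b * t) :
    HasDerivAt (fun t : ℝ => (a + b * t) ^ ν) (b * ν * (a + b * t) ^ (ν - 1)) t := by
  have h₁ : HasDerivAt (fun t : ℝ => a + b * t) b t := by
    simpa using ((hasDerivAt_id t).const_mul b).const_add a
  exact h₁.rpow_const (Or.inl h.ne')

/-- Cauchy's mean value theorem for real powers of two affine functions. -/
theorem exists_add_mul_rpow_ratio_eq {a b c d ν l r : ℝ} (hlr : l < r)
    (hab : ∀ t ∈ Set.Icc l r, 0 < a + b * t) (hcd : ∀ t ∈ Set.Icc l r, 0 < c + d * t) :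
    ∃ t ∈ Set.Ioo l r,
      ((c + d * r) ^ ν - (c + d * l) ^ ν) * (b * ν * (a + b * t) ^ (ν - 1)) =
        ((a + b * r) ^ ν - (a + b * l) ^ ν) * (d * ν * (c + d * t) ^ (ν - 1)) :=
  exists_ratio_hasDerivAt_eq_ratio_slope (fun t => (a + b * t) ^ ν) _ hlr
    (fun t ht => (hasDerivAt_add_mul_rpow (hab t ht)).continuousAt.continuousWithinAt)
    (fun t ht => hasDerivAt_add_mul_rpow (hab t (Set.Ioo_subset_Icc_self ht)))
    (fun t => (c + d * t) ^ ν) _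
    (fun t ht => (hasDerivAt_add_mul_rpow (hcd t ht)).continuousAt.continuousWithinAt)
    (fun t ht => hasDerivAt_add_mul_rpow (hcd t (Set.Ioo_subset_Icc_self ht)))

/-- The cross-multiplied form of the monotonicity of
`x ↦ ((x + s) ^ ν - s ^ ν) / (x * ((x + s) ^ ν - (x + w) ^ ν))`. -/
theorem rpow_sub_mul_le_rpow_sub_mul {w s ν x y : ℝ} (hw : 0 < w) (hws : w < s) (hν0 : 0 < ν)
    (hν1 : ν ≤ 1) (hx : 0 < x) (hxy : x ≤ y) :
    ((x + s) ^ ν - s ^ ν) * y * ((y + s) ^ ν - (y + w) ^ ν) ≤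
      ((y + s) ^ ν - s ^ ν) * x * ((x + s) ^ ν - (x + w) ^ ν) := by
  have hs : 0 < s := hw.trans hws
  have hy : 0 < y := hx.trans_le hxy
  obtain ⟨u, ⟨hwu, hus⟩, hu⟩ := exists_add_mul_rpow_ratio_eq (a := x) (b := 1) (c := y) (d := 1)
    (ν := ν) hws (fun t ht => by linarith [ht.1]) (fun t ht => by linarith [ht.1])
  obtain ⟨t, ⟨ht0, ht1⟩, ht⟩ := exists_add_mul_rpow_ratio_eq (a := s) (b := x) (c := s) (d := y)
    (ν := ν) zero_lt_one (fun t ht => by nlinarith [ht.1]) (fun t ht => by nlinarith [ht.1])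
  simp only [one_mul, mul_one, mul_zero, zero_add, add_comm s] at hu ht
  have hu0 : 0 < u := hw.trans hwu
  have hA : 0 ≤ (y + s) ^ ν - s ^ ν :=
    sub_nonneg.2 (Real.rpow_le_rpow hs.le (by linarith) hν0.le)
  have hD : 0 ≤ (x + s) ^ ν - (x + w) ^ ν :=
    sub_nonneg.2 (Real.rpow_le_rpow (by positivity) (by linarith) hν0.le)
  have hP : 0 < (y * t + s) ^ (ν - 1) := by positivity
  have hQ : 0 < (x + u) ^ (ν - 1) := by positivity
  have key : (x * t + s) ^ (ν - 1) * (y + u) ^ (ν - 1) ≤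
      (y * t + s) ^ (ν - 1) * (x + u) ^ (ν - 1) := by
    rw [← Real.mul_rpow (by positivity) (by positivity),
      ← Real.mul_rpow (by positivity) (by positivity)]
    have htu : t * u ≤ s := by nlinarith
    exact Real.rpow_le_rpow_of_nonpos (by positivity) (by nlinarith) (by linarith)
  generalize (x + s) ^ ν - s ^ ν = Ax at *
  generalize (y + s) ^ ν - s ^ ν = Ay at *
  generalize (x + s) ^ ν - (x + w) ^ ν = Dx at *
  generalize (y + s) ^ ν - (y + w) ^ ν = Dy at *
  generalize (x * t + s) ^ (ν - 1) = P at *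
  generalize (y + u) ^ (ν - 1) = Q at *
  generalize (y * t + s) ^ (ν - 1) = P' at *
  generalize (x + u) ^ (ν - 1) = Q' at *
  have hu' : Dy * Q' = Dx * Q := mul_left_cancel₀ hν0.ne' (by linarith)
  have ht' : Ay * (x * P) = Ax * (y * P') := mul_left_cancel₀ hν0.ne' (by linarith)
  refine le_of_mul_le_mul_right ?_ (mul_pos hP hQ)
  calc Ax * y * Dy * (P' * Q') = Ax * (y * P') * (Dy * Q') := by ring
    _ = Ay * x * Dx * (P * Q) := by rw [← ht', hu']; ring
    _ ≤ Ay * x * Dx * (P' * Q') := mul_le_mul_of_nonneg_left key (by positivity)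


/-- Superadditivity step in the upper bound of Theorem 10: for
`f(x) = ((x + p_s)^ν − p_s^ν)/((x + p_s)^ν − (x + p_w)^ν)` and nonnegative bribes
`p_b(1), …, p_b(n)` with `∑ p_b(i) ≤ p_0`, one has `∑ f(p_b(i)) ≤ f(p_0)`. -/
theorem withholding_probability_sum_le (p_w p_s ν : ℝ)
    (hw : 0 < p_w) (hws : p_w < p_s) (hν0 : 0 < ν) (hν1 : ν ≤ 1)
    (f : ℝ → ℝ)
    (hf : ∀ x : ℝ, 0 ≤ x →
      f x = ((x + p_s) ^ ν - p_s ^ ν) / ((x + p_s) ^ ν - (x + p_w) ^ ν))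
    (n : ℕ) (hn : 1 ≤ n) (p_b : Fin n → ℝ) (hpb : ∀ i, 0 ≤ p_b i)
    (p_0 : ℝ) (hp0 : 0 ≤ p_0) (hsum : ∑ i, p_b i ≤ p_0) :
    ∑ i, f (p_b i) ≤ f p_0 := by
  have hs : 0 < p_s := hw.trans hws
  have hD : ∀ x, 0 ≤ x → 0 < (x + p_s) ^ ν - (x + p_w) ^ ν := fun x hx =>
    sub_pos.2 (Real.rpow_lt_rpow (by positivity) (by linarith) hν0)
  have hf0 : f 0 = 0 := by simp [hf 0 le_rfl]
  have hfnn : 0 ≤ f p_0 := by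
    rw [hf p_0 hp0]
    exact div_nonneg (sub_nonneg.2 (Real.rpow_le_rpow hs.le (by linarith) hν0.le)) (hD p_0 hp0).le
  have hle : ∀ i, p_b i ≤ p_0 := fun i =>
    (Finset.single_le_sum (fun j _ => hpb j) (Finset.mem_univ i)).trans hsum
  have hmul : ∀ i, f (p_b i) * p_0 ≤ f p_0 * p_b i := by
    intro i
    rcases (hpb i).eq_or_lt with h | h
    · simp [← h, hf0]
    · rw [hf _ (hpb i), hf p_0 hp0, div_mul_eq_mul_div, div_mul_eq_mul_div,
        div_le_div_iff₀ (hD _ (hpb i)) (hD p_0 hp0)]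
      exact rpow_sub_mul_le_rpow_sub_mul hw hws hν0 hν1 h (hle i)
  rcases hp0.eq_or_lt with h | h
  · have hzero : ∀ i, p_b i = 0 := fun i => le_antisymm (h ▸ hle i) (hpb i)
    simp [hzero, ← h, hf0]
  · refine le_of_mul_le_mul_right ?_ h
    calc (∑ i, f (p_b i)) * p_0 ≤ ∑ i, f p_0 * p_b i := by
          rw [Finset.sum_mul]
          exact Finset.sum_le_sum fun i _ => hmul i
      _ = f p_0 * ∑ i, p_b i := (Finset.mul_sum ..).symm
      _ ≤ f p_0 * p_0 := mul_le_mul_of_nonneg_left hsum hfnn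
end

section
/- Fix reals p_w, p_s with 0 < p_w < p_s and ν ∈ (0,1], and define f(x) = ((x + p_s)^ν − p_s^ν) / ((x + p_s)^ν − (x + p_w)^ν) for x ≥ 0. Fix integers n, m with 1 ≤ m ≤ n, let 𝒢 be the collection of all m-element subsets of {1,…,n}, and for each i let 𝒢_i = {G ∈ 𝒢 : i ∈ G}. Let p_0 be a real with 0 ≤ p_0 ≤ m·(p_s − p_w). Then there exist x : 𝒢 → [0,1] and p_b : {1,…,n} → [0,∞) with ∑_{i=1}^n p_b(i) ≤ p_0 and ∑_{G ∈ 𝒢_i} x_G ≤ f(p_b(i)) for every i ∈ {1,…,n}, such that ∑_{G ∈ 𝒢} x_G = f(p_0/m). In particular, 0 ≤ f(p_0/m) ≤ 1. -/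
/-- Feasibility construction behind the lower bound of Theorem 10: for
`f(x) = ((x + p_s)^ν − p_s^ν)/((x + p_s)^ν − (x + p_w)^ν)` and `0 ≤ p_0 ≤ m·(p_s − p_w)`,
there are weights `x : 𝒢 → [0,1]` and nonnegative bribes `p_b` summing to at most `p_0`
satisfying the per-node constraints with `∑_{G ∈ 𝒢} x_G = f(p_0/m)`; in particular
`0 ≤ f(p_0/m) ≤ 1`. -/
theorem risk_averse_failure_probability_lower_bound_feasible
    (p_w p_s ν : ℝ) (hw : 0 < p_w) (hws : p_w < p_s) (hν0 : 0 < ν) (hν1 : ν ≤ 1)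
    (f : ℝ → ℝ)
    (hf : ∀ x : ℝ, 0 ≤ x →
      f x = ((x + p_s) ^ ν - p_s ^ ν) / ((x + p_s) ^ ν - (x + p_w) ^ ν))
    (n m : ℕ) (hm1 : 1 ≤ m) (hmn : m ≤ n)
    (p_0 : ℝ) (hp00 : 0 ≤ p_0) (hp0m : p_0 ≤ m * (p_s - p_w)) :
    (∃ (x : Finset (Fin n) → ℝ) (p_b : Fin n → ℝ),
      (∀ G ∈ Finset.powersetCard m (Finset.univ : Finset (Fin n)),
          0 ≤ x G ∧ x G ≤ 1) ∧
      (∀ i, 0 ≤ p_b i) ∧ (∑ i, p_b i ≤ p_0) ∧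
      (∀ i : Fin n,
        ∑ G ∈ (Finset.powersetCard m (Finset.univ : Finset (Fin n))).filter
            (fun G => i ∈ G), x G ≤ f (p_b i)) ∧
      ∑ G ∈ Finset.powersetCard m (Finset.univ : Finset (Fin n)), x G = f (p_0 / m)) ∧
    0 ≤ f (p_0 / m) ∧ f (p_0 / m) ≤ 1 := by
  have hm : (0 : ℝ) < m := by exact_mod_cast hm1
  have hy : 0 ≤ p_0 / m := by positivity
  have hyle : p_0 / m ≤ p_s - p_w := by
    rw [div_le_iff₀ hm]
    linarith
  have hf0 : f 0 = 0 := by simp [hf 0 le_rfl]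
  have hden : 0 < (p_0 / m + p_s) ^ ν - (p_0 / m + p_w) ^ ν :=
    sub_pos.2 (Real.rpow_lt_rpow (by linarith) (by linarith) hν0)
  have hfnonneg : 0 ≤ f (p_0 / m) := by
    rw [hf _ hy]
    exact div_nonneg
      (sub_nonneg.2 (Real.rpow_le_rpow (by linarith) (by linarith) hν0.le)) hden.le
  have hfle : f (p_0 / m) ≤ 1 := by
    rw [hf _ hy, div_le_one hden]
    exact sub_le_sub_left (Real.rpow_le_rpow (by linarith) (by linarith) hν0.le) _
  refine ⟨?_, hfnonneg, hfle⟩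
  obtain ⟨G₀, -, hG₀⟩ := Finset.exists_subset_card_eq
    (s := (Finset.univ : Finset (Fin n))) (n := m) (by simpa using hmn)
  refine ⟨fun G => if G = G₀ then f (p_0 / m) else 0,
    fun i => if i ∈ G₀ then p_0 / m else 0, ?_, ?_, ?_, ?_, ?_⟩
  · intro G _
    dsimp only
    split_ifs
    · exact ⟨hfnonneg, hfle⟩
    · norm_num
  · intro i
    dsimp only
    split_ifs
    · exact hy
    · exact le_rfl
  · rw [Finset.sum_ite_mem, Finset.univ_inter, Finset.sum_const, hG₀, nsmul_eq_mul,
      mul_div_cancel₀ _ hm.ne']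
  · intro i
    rw [Finset.sum_ite_eq']
    by_cases hi : i ∈ G₀ <;> simp [hi, hG₀, hf0]
  · rw [Finset.sum_ite_eq']
    simp [hG₀]
end

section
/- Let (Ω, 𝔄, μ) be a probability space. Fix integers n, m with 1 ≤ m ≤ n and reals p_w, p_s, p_0 with 0 ≤ p_w < p_s and p_0 ≥ 0. Let 𝒢 be the collection of all m-element subsets of {1,…,n}, and for each i let 𝒢_i = {G ∈ 𝒢 : i ∈ G}. Let (E_G)_{G ∈ 𝒢} be measurable sets, and let p_b : {1,…,n} → [0,∞) satisfy ∑_{i=1}^n p_b(i) ≤ p_0 and μ(⋃_{G ∈ 𝒢_i} E_G) ≤ p_b(i)/(p_s − p_w) for every i. Then μ(⋃_{G ∈ 𝒢} E_G) ≤ p_0 / (m·(p_s − p_w)). -/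
open MeasureTheory ENNReal

/-- If every point of `U` lies in at least `m` of the measurable sets `A i`, then `m * μ U` is at
most the sum of the measures of the `A i`. -/
theorem natCast_mul_measure_le_sum_measure {Ω ι : Type*} [MeasurableSpace Ω] (μ : Measure Ω)
    [Fintype ι] {A : ι → Set Ω} (hA : ∀ i, MeasurableSet (A i)) {U : Set Ω} {m : ℕ}
    (h : ∀ ω ∈ U, ∃ G : Finset ι, G.card = m ∧ ∀ i ∈ G, ω ∈ A i) :
    (m : ℝ≥0∞) * μ U ≤ ∑ i, μ (A i) := by
  have hmeas : ∀ i, Measurable ((A i).indicator (1 : Ω → ℝ≥0∞)) := fun i =>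
    measurable_one.indicator (hA i)
  calc (m : ℝ≥0∞) * μ U
      ≤ m * μ {ω | (m : ℝ≥0∞) ≤ ∑ i, (A i).indicator 1 ω} := by
        gcongr
        intro ω hω
        obtain ⟨G, hG, hGA⟩ := h ω hω
        calc (m : ℝ≥0∞) = ∑ i ∈ G, (A i).indicator 1 ω := by
              rw [Finset.sum_congr rfl fun i hi => Set.indicator_of_mem (hGA i hi) 1]
              simp [hG]
          _ ≤ ∑ i, (A i).indicator 1 ω :=
              Finset.sum_le_sum_of_subset (Finset.subset_univ G)
    _ ≤ ∫⁻ ω, ∑ i, (A i).indicator 1 ω ∂μ :=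
        mul_meas_ge_le_lintegral (Finset.measurable_fun_sum _ fun i _ => hmeas i) _
    _ = ∑ i, μ (A i) := by
        rw [lintegral_finsetSum _ fun i _ => hmeas i]
        exact Finset.sum_congr rfl fun i _ => lintegral_indicator_one (hA i)

/-- Probabilistic form of the upper bound of Theorem 5 (risk-neutral case): if each event
`⋃_{G ∋ i} E_G` has probability at most `p_b(i)/(p_s − p_w)` for nonnegative bribes summing
to at most `p_0`, then `μ(⋃_G E_G) ≤ p_0/(m·(p_s − p_w))`. -/
theorem risk_neutral_failure_event_probability_bound {Ω : Type*} [MeasurableSpace Ω]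
    (μ : Measure Ω) [IsProbabilityMeasure μ]
    (n m : ℕ) (hm1 : 1 ≤ m) (hmn : m ≤ n)
    (p_w p_s p_0 : ℝ) (hw : 0 ≤ p_w) (hws : p_w < p_s) (hp0 : 0 ≤ p_0)
    (E : Finset (Fin n) → Set Ω) (hE : ∀ G, MeasurableSet (E G))
    (p_b : Fin n → ℝ) (hpb : ∀ i, 0 ≤ p_b i) (hsum : ∑ i, p_b i ≤ p_0)
    (hcon : ∀ i : Fin n,
      μ (⋃ G ∈ (Finset.powersetCard m (Finset.univ : Finset (Fin n))).filter
          (fun G => i ∈ G), E G) ≤ ENNReal.ofReal (p_b i / (p_s - p_w))) :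
    μ (⋃ G ∈ Finset.powersetCard m (Finset.univ : Finset (Fin n)), E G)
      ≤ ENNReal.ofReal (p_0 / (m * (p_s - p_w))) := by
  have hd : 0 < p_s - p_w := sub_pos.mpr hws
  have hm : (0 : ℝ) < m := by exact_mod_cast hm1
  have hcount : (m : ℝ≥0∞) * μ (⋃ G ∈ Finset.powersetCard m (Finset.univ : Finset (Fin n)), E G)
      ≤ ∑ i : Fin n, μ (⋃ G ∈ (Finset.powersetCard m (Finset.univ : Finset (Fin n))).filter
          (fun G => i ∈ G), E G) := by
    refine natCast_mul_measure_le_sum_measure μ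
      (fun i => Finset.measurableSet_biUnion _ fun G _ => hE G) fun ω hω => ?_
    obtain ⟨G, hG, hωG⟩ := Set.mem_iUnion₂.mp hω
    exact ⟨G, (Finset.mem_powersetCard.mp hG).2, fun i hi =>
      Set.mem_iUnion₂.mpr ⟨G, Finset.mem_filter.mpr ⟨hG, hi⟩, hωG⟩⟩
  have hbribe : ∑ i, ENNReal.ofReal (p_b i / (p_s - p_w)) ≤ ENNReal.ofReal (p_0 / (p_s - p_w)) := by
    rw [← ENNReal.ofReal_sum_of_nonneg fun i _ => div_nonneg (hpb i) hd.le, ← Finset.sum_div]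
    gcongr
  rw [mul_comm (m : ℝ), ← div_div, ENNReal.ofReal_div_of_pos hm, ENNReal.ofReal_natCast,
    ENNReal.le_div_iff_mul_le (Or.inl (Nat.cast_ne_zero.mpr (Nat.one_le_iff_ne_zero.mp hm1)))
      (Or.inl (ENNReal.natCast_ne_top m)), mul_comm]
  exact hcount.trans ((Finset.sum_le_sum fun i _ => hcon i).trans hbribe)
end
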